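/- For every n there is a bijection ψ between U_n and S_n such that if τ ∈ U_n and σ = ψ(τ), then D(τ) = D(σ); moreover if the entry n+1 occupies position k of τ, then σ(k) = n. -/

import Mathlib

def descSeq {n : ℕ} (f : Fin n → ℕ) : Finset ℕ :=
  (Finset.range (n - 1)).filter
    (fun i => ∃ h : i + 1 < n, f ⟨i + 1, h⟩ < f ⟨i, Nat.lt_of_succ_lt h⟩)

def descSet {n : ℕ} (σ : Equiv.Perm (Fin n)) : Finset ℕ :=
  descSeq (fun i => (σ i : ℕ))

def IsCyclic' {n : ℕ} (π : Equiv.Perm (Fin n)) : Prop :=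
  ∀ x y : Fin n, ∃ k : ℕ, (π ^ k) x = y

def compParts (n : ℕ) (I : Finset ℕ) : Multiset ℕ :=
  ↑(List.zipWith (· - ·) ((I.sort (· ≤ ·)).map (· + 1) ++ [n])
      (0 :: (I.sort (· ≤ ·)).map (· + 1)))

def fullCycleType {n : ℕ} (π : Equiv.Perm (Fin n)) : Multiset ℕ :=
  π.cycleType + Multiset.replicate (n - π.support.card) 1

def InT0 (n : ℕ) (τ : Fin n → ℕ) : Prop :=
  ∃ (π : Equiv.Perm (Fin n)) (k : Fin n), IsCyclic' π ∧
    τ = Function.update (fun i => ((π i : ℕ) + 1)) k 0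

def InU (n : ℕ) (τ : Fin n → ℕ) : Prop :=
  ∃ (π : Equiv.Perm (Fin n)) (k : Fin n), IsCyclic' π ∧
    τ = Function.update (fun i => ((π i : ℕ) + 1)) k (n + 1)

def extPerm {n : ℕ} (π : Equiv.Perm (Fin n)) : Equiv.Perm (Fin (n + 1)) :=
  (finSuccEquivLast (n := n)).symm.permCongr π.optionCongr

def extCycle {n : ℕ} (π : Equiv.Perm (Fin n)) (k : Fin n) : Equiv.Perm (Fin (n + 1)) :=
  extPerm π * Equiv.swap (Fin.castSucc k) (Fin.last n)

/-- `f` is strictly increasing on each fibre of `β`. -/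
def StrictMonoOnFibers {n : ℕ} {α : Type*} [LT α] (β : Fin n → ℕ) (f : Fin n → α) : Prop :=
  ∀ ⦃x y⦄, x < y → β x = β y → f x < f y

/-- The one-based values of `t`, followed by `n + 1`. -/
def valueOrTop {n : ℕ} (t : Equiv.Perm (Fin n)) (j : ℕ) : ℕ :=
  if h : j < n then (t ⟨j, h⟩ : ℕ) + 1 else n + 1

/-- The sequence sending each entry of the list `t 0, t 1, …, n + 1` to its successor. -/
def successorSeq {n : ℕ} (t : Equiv.Perm (Fin n)) (x : Fin n) : ℕ :=
  valueOrTop t ((t.symm x : ℕ) + 1)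

/-- A finite word continued by `⊤` forever. -/
def padTop {n : ℕ} (w : Fin n → ℕ) (j : ℕ) : WithTop ℕ :=
  if h : j < n then (w ⟨j, h⟩ : WithTop ℕ) else ⊤

/-- The suffix of the word `w` starting at `i`, ordered lexicographically. -/
def suffixKey {n : ℕ} (w : Fin n → ℕ) (i : ℕ) : Lex (ℕ → WithTop ℕ) :=
  toLex fun m => padTop w (i + m)

section Suffix

variable {n : ℕ} (w : Fin n → ℕ)

theorem suffixKey_lt_iff (i j : ℕ) : suffixKey w i < suffixKey w j ↔
    ∃ m, (∀ l < m, padTop w (i + l) = padTop w (j + l)) ∧ padTop w (i + m) < padTop w (j + m) :=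
  Iff.rfl

theorem suffixKey_lt_of_padTop_lt {i j : ℕ} (h : padTop w i < padTop w j) :
    suffixKey w i < suffixKey w j :=
  (suffixKey_lt_iff w i j).2 ⟨0, by simp, by simpa using h⟩

theorem suffixKey_lt_iff_succ {i j : ℕ} (h : padTop w i = padTop w j) :
    suffixKey w i < suffixKey w j ↔ suffixKey w (i + 1) < suffixKey w (j + 1) := by
  simp only [suffixKey_lt_iff]
  constructor
  · rintro ⟨_ | m, h1, h2⟩
    · simp [h] at h2
    · refine ⟨m, fun l hl => ?_, ?_⟩
      · have := h1 (l + 1) (by omega)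
        rwa [← add_assoc, ← add_assoc, add_right_comm i, add_right_comm j] at this
      · rwa [← add_assoc, ← add_assoc, add_right_comm i, add_right_comm j] at h2
  · rintro ⟨m, h1, h2⟩
    refine ⟨m + 1, fun l hl => ?_, ?_⟩
    · rcases l with _ | l
      · simpa using h
      · have := h1 l (by omega)
        rwa [← add_assoc, ← add_assoc, add_right_comm i, add_right_comm j]
    · rwa [← add_assoc, ← add_assoc, add_right_comm i, add_right_comm j]

theorem padTop_le_of_suffixKey_le {i j : ℕ} (h : suffixKey w i ≤ suffixKey w j) :
    padTop w i ≤ padTop w j := by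
  by_contra! hlt
  exact absurd h (suffixKey_lt_of_padTop_lt w hlt).not_ge

theorem padTop_of_lt {i : ℕ} (h : i < n) : padTop w i = (w ⟨i, h⟩ : WithTop ℕ) := dif_pos h

theorem padTop_of_le {i : ℕ} (h : n ≤ i) : padTop w i = ⊤ := dif_neg h.not_gt

theorem not_suffixKey_lt_of_le {i j : ℕ} (h : n ≤ i) : ¬ suffixKey w i < suffixKey w j := by
  rw [suffixKey_lt_iff]
  rintro ⟨m, -, h2⟩
  rw [padTop_of_le w (by omega : n ≤ i + m)] at h2
  exact not_top_lt h2

theorem suffixKey_ne {i j : ℕ} (hij : i < j) (hj : j ≤ n) : suffixKey w i ≠ suffixKey w j := by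
  intro h
  have h1 : padTop w (i + (n - j)) = padTop w (j + (n - j)) := congrFun h (n - j)
  rw [padTop_of_lt w (by omega : i + (n - j) < n),
    padTop_of_le w (by omega : n ≤ j + (n - j))] at h1
  exact WithTop.coe_ne_top h1

theorem suffixKey_injective : Function.Injective fun i : Fin n => suffixKey w i := by
  intro i j h
  by_contra hne
  rcases lt_or_gt_of_ne hne with hlt | hlt
  · exact suffixKey_ne w hlt j.2.le h
  · exact suffixKey_ne w hlt i.2.le h.symm

end Suffix

theorem exists_perm_ordered_by {n : ℕ} {K : Type*} [LinearOrder K] {β : Fin n → ℕ}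
    (hβ : Monotone β) (s : Equiv.Perm (Fin n)) (f : Fin n → K) (hf : Function.Injective f)
    (hle : ∀ i j, f i ≤ f j → β (s i) ≤ β (s j)) :
    ∃ t : Equiv.Perm (Fin n), β ∘ t = β ∘ s ∧ ∀ i j, t i < t j ↔ f i < f j := by
  have hmono := Tuple.monotone_sort f
  have hstrict : StrictMono (f ∘ Tuple.sort f) :=
    hmono.strictMono_of_injective (hf.comp (Tuple.sort f).injective)
  refine ⟨(Tuple.sort f)⁻¹, ?_, fun i j => ?_⟩
  · have h := Tuple.unique_monotone (f := β ∘ s) (σ := Tuple.sort f) (τ := s⁻¹)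
      (fun x y hxy => hle _ _ (hmono hxy)) (by simpa [Function.comp_def] using hβ)
    funext i
    have := congrFun h ((Tuple.sort f)⁻¹ i)
    simpa using this.symm
  · rw [← hstrict.lt_iff_lt]
    simp

theorem perm_eq_of_lt_iff {n : ℕ} {s t : Equiv.Perm (Fin n)}
    (h : ∀ i j, s i < s j ↔ t i < t j) : s = t := by
  have hm : Monotone (t * s⁻¹) := by
    refine StrictMono.monotone fun x y hxy => ?_
    simpa using (h (s⁻¹ x) (s⁻¹ y)).1 (by simpa using hxy)
  exact (mul_inv_eq_one.1 ((Equiv.Perm.monotone_iff _).1 hm)).symm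

section Blocks

variable {n : ℕ} {β : Fin n → ℕ}

theorem valueOrTop_of_lt (t : Equiv.Perm (Fin n)) {j : ℕ} (h : j < n) :
    valueOrTop t j = t ⟨j, h⟩ + 1 := dif_pos h

theorem valueOrTop_of_le (t : Equiv.Perm (Fin n)) {j : ℕ} (h : n ≤ j) :
    valueOrTop t j = n + 1 := dif_neg h.not_gt

theorem valueOrTop_le (t : Equiv.Perm (Fin n)) (j : ℕ) : valueOrTop t j ≤ n + 1 := by
  unfold valueOrTop
  split_ifs <;> omega

theorem valueOrTop_injOn (t : Equiv.Perm (Fin n)) : Set.InjOn (valueOrTop t) (Set.Iic n) := by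
  intro i hi j hj h
  simp only [Set.mem_Iic] at hi hj
  unfold valueOrTop at h
  split_ifs at h with h1 h2 h2
  · simpa [Fin.val_inj] using h
  · have := (t ⟨i, h1⟩).2
    omega
  · have := (t ⟨j, h2⟩).2
    omega
  · omega

theorem successorSeq_injective (t : Equiv.Perm (Fin n)) :
    Function.Injective (successorSeq t) := by
  intro x y h
  have := valueOrTop_injOn t (Set.mem_Iic.2 (t.symm x).2) (Set.mem_Iic.2 (t.symm y).2) h
  exact t.symm.injective (Fin.ext (by omega))

theorem suffixKey_lt_of_valueOrTop_lt (hβ : Monotone β) {t : Equiv.Perm (Fin n)}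
    (ht : StrictMonoOnFibers β (successorSeq t)) {i : ℕ} (hi : i ≤ n) :
    ∀ {j : ℕ}, valueOrTop t i < valueOrTop t j →
      suffixKey (β ∘ t) i < suffixKey (β ∘ t) j := by
  induction hi using Nat.decreasingInduction with
  | self =>
    intro j h
    rw [valueOrTop_of_le t le_rfl] at h
    exact absurd (valueOrTop_le t j) (by omega)
  | of_succ i hi ih =>
    intro j h
    rcases lt_or_ge j n with hj | hj
    · have hlt : t ⟨i, hi⟩ < t ⟨j, hj⟩ := by
        rw [valueOrTop_of_lt t hi, valueOrTop_of_lt t hj] at h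
        exact Fin.lt_def.2 (by omega)
      rcases (hβ hlt.le).lt_or_eq with hb | hb
      · apply suffixKey_lt_of_padTop_lt
        rw [padTop_of_lt _ hi, padTop_of_lt _ hj]
        exact WithTop.coe_lt_coe.2 hb
      · rw [suffixKey_lt_iff_succ]
        · have := ht hlt hb
          simp only [successorSeq, Equiv.symm_apply_apply] at this
          exact ih this
        · rw [padTop_of_lt _ hi, padTop_of_lt _ hj]
          exact congrArg _ hb
    · apply suffixKey_lt_of_padTop_lt
      rw [padTop_of_lt _ hi, padTop_of_le _ hj]
      exact WithTop.coe_lt_top _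

theorem lt_iff_suffixKey_lt (hβ : Monotone β) {t : Equiv.Perm (Fin n)}
    (ht : StrictMonoOnFibers β (successorSeq t)) (i j : Fin n) :
    t i < t j ↔ suffixKey (β ∘ t) i < suffixKey (β ∘ t) j := by
  have key : ∀ i j : Fin n, t i < t j → suffixKey (β ∘ t) i < suffixKey (β ∘ t) j := by
    intro i j h
    apply suffixKey_lt_of_valueOrTop_lt hβ ht i.2.le
    rw [valueOrTop_of_lt t i.2, valueOrTop_of_lt t j.2]
    simpa using h
  refine ⟨key i j, fun h => ?_⟩
  rcases lt_trichotomy (t i) (t j) with h1 | h1 | h1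
  · exact h1
  · rw [t.injective h1] at h
    exact absurd h (lt_irrefl _)
  · exact absurd h (key j i h1).not_gt

theorem strictMonoOnFibers_successorSeq {t : Equiv.Perm (Fin n)}
    (ht : ∀ i j : Fin n, t i < t j ↔ suffixKey (β ∘ t) i < suffixKey (β ∘ t) j) :
    StrictMonoOnFibers β (successorSeq t) := by
  intro x y hxy hb
  obtain ⟨i, rfl⟩ := t.surjective x
  obtain ⟨j, rfl⟩ := t.surjective y
  simp only [successorSeq, Equiv.symm_apply_apply]
  have h := (ht i j).1 hxy
  rw [suffixKey_lt_iff_succ] at h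
  · rcases lt_or_ge ((i : ℕ) + 1) n with hi | hi
    · rw [valueOrTop_of_lt t hi]
      rcases lt_or_ge ((j : ℕ) + 1) n with hj | hj
      · rw [valueOrTop_of_lt t hj]
        have := (ht ⟨i + 1, hi⟩ ⟨j + 1, hj⟩).2 h
        simpa using this
      · rw [valueOrTop_of_le t hj]
        have := (t ⟨i + 1, hi⟩).2
        omega
    · exact absurd h (not_suffixKey_lt_of_le _ hi)
  · rw [padTop_of_lt _ i.2, padTop_of_lt _ j.2]
    exact congrArg _ hb

theorem lt_iff_toLex_lt (hβ : Monotone β) {s : Equiv.Perm (Fin n)}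
    (hs : StrictMonoOnFibers β s.symm) (i j : Fin n) :
    s i < s j ↔ toLex (β (s i), i) < toLex (β (s j), j) := by
  have key : ∀ i j : Fin n, s i < s j → toLex (β (s i), i) < toLex (β (s j), j) := by
    intro i j h
    rw [Prod.Lex.toLex_lt_toLex]
    rcases (hβ h.le).lt_or_eq with hb | hb
    · exact Or.inl hb
    · exact Or.inr ⟨hb, by simpa using hs h hb⟩
  refine ⟨key i j, fun h => ?_⟩
  rcases lt_trichotomy (s i) (s j) with h1 | h1 | h1
  · exact h1
  · rw [s.injective h1] at h
    exact absurd h (lt_irrefl _)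
  · exact absurd h (key j i h1).not_gt

theorem strictMonoOnFibers_symm {s : Equiv.Perm (Fin n)}
    (hs : ∀ i j : Fin n, s i < s j ↔ toLex (β (s i), i) < toLex (β (s j), j)) :
    StrictMonoOnFibers β s.symm := by
  intro x y hxy hb
  obtain ⟨i, rfl⟩ := s.surjective x
  obtain ⟨j, rfl⟩ := s.surjective y
  have h := (hs i j).1 hxy
  rw [Prod.Lex.toLex_lt_toLex] at h
  rcases h with h | h
  · exact absurd hb h.ne
  · simpa using h.2

theorem eq_of_comp_eq_of_successorSeq (hβ : Monotone β) {s t : Equiv.Perm (Fin n)}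
    (hs : StrictMonoOnFibers β (successorSeq s)) (ht : StrictMonoOnFibers β (successorSeq t))
    (h : β ∘ s = β ∘ t) : s = t :=
  perm_eq_of_lt_iff fun i j => by
    rw [lt_iff_suffixKey_lt hβ hs, lt_iff_suffixKey_lt hβ ht, h]

theorem eq_of_comp_eq_of_symm (hβ : Monotone β) {s t : Equiv.Perm (Fin n)}
    (hs : StrictMonoOnFibers β s.symm) (ht : StrictMonoOnFibers β t.symm)
    (h : β ∘ s = β ∘ t) : s = t :=
  perm_eq_of_lt_iff fun i j => by
    have hc : ∀ i, β (s i) = β (t i) := congrFun h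
    rw [lt_iff_toLex_lt hβ hs, lt_iff_toLex_lt hβ ht, hc, hc]

theorem exists_successorSeq_of_word (hβ : Monotone β) (s : Equiv.Perm (Fin n)) :
    ∃ t : Equiv.Perm (Fin n), β ∘ t = β ∘ s ∧ StrictMonoOnFibers β (successorSeq t) := by
  obtain ⟨t, h1, h2⟩ := exists_perm_ordered_by hβ s _ (suffixKey_injective (β ∘ s))
    fun i j h => by
      have := padTop_le_of_suffixKey_le _ h
      rw [padTop_of_lt _ i.2, padTop_of_lt _ j.2] at this
      exact WithTop.coe_le_coe.1 this
  exact ⟨t, h1, strictMonoOnFibers_successorSeq (by rwa [h1])⟩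

theorem exists_symm_of_word (hβ : Monotone β) (s : Equiv.Perm (Fin n)) :
    ∃ t : Equiv.Perm (Fin n), β ∘ t = β ∘ s ∧ StrictMonoOnFibers β t.symm := by
  obtain ⟨t, h1, h2⟩ := exists_perm_ordered_by hβ s (fun i => toLex (β (s i), i))
    (fun i j h => by simpa using congrArg (fun p => (ofLex p).2) h)
    fun i j h => by
      rw [Prod.Lex.toLex_le_toLex] at h
      rcases h with h | h
      · exact h.le
      · exact h.1.le
  have hc : ∀ i, β (t i) = β (s i) := congrFun h1
  exact ⟨t, h1, strictMonoOnFibers_symm (by simpa only [hc] using h2)⟩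

end Blocks

section Last

variable {m : ℕ} {β : Fin (m + 1) → ℕ} {t : Equiv.Perm (Fin (m + 1))}

theorem successorSeq_last (t : Equiv.Perm (Fin (m + 1))) :
    successorSeq t (t (Fin.last m)) = m + 1 + 1 := by
  simp [successorSeq, valueOrTop]

theorem successorSeq_eq_iff (t : Equiv.Perm (Fin (m + 1))) (x : Fin (m + 1)) :
    successorSeq t x = m + 1 + 1 ↔ t (Fin.last m) = x := by
  rw [← successorSeq_last t, (successorSeq_injective t).eq_iff, eq_comm]

theorem le_apply_last_of_successorSeq (ht : StrictMonoOnFibers β (successorSeq t))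
    {x : Fin (m + 1)} (hx : β x = β (t (Fin.last m))) : x ≤ t (Fin.last m) := by
  by_contra! h
  have := ht h hx.symm
  rw [successorSeq_last] at this
  exact absurd (valueOrTop_le t _) this.not_ge

theorem le_apply_last_of_symm (ht : StrictMonoOnFibers β t.symm)
    {x : Fin (m + 1)} (hx : β x = β (t (Fin.last m))) : x ≤ t (Fin.last m) := by
  by_contra! h
  have := ht h hx.symm
  rw [Equiv.symm_apply_apply] at this
  exact absurd (Fin.le_last _) this.not_ge

theorem apply_last_eq {s t : Equiv.Perm (Fin (m + 1))} (h : β ∘ s = β ∘ t)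
    (hs : StrictMonoOnFibers β (successorSeq s)) (ht : StrictMonoOnFibers β t.symm) :
    s (Fin.last m) = t (Fin.last m) := by
  have hl : β (s (Fin.last m)) = β (t (Fin.last m)) := congrFun h _
  exact le_antisymm (le_apply_last_of_symm ht hl) (le_apply_last_of_successorSeq hs hl.symm)

end Last

section Descents

variable {n : ℕ}

/-- The number of elements of `I` below `x`: its fibres are the blocks cut out by `I`. -/
def blockIndex (I : Finset ℕ) (x : Fin n) : ℕ := (I.filter (· < (x : ℕ))).card

theorem blockIndex_monotone (I : Finset ℕ) : Monotone (blockIndex I : Fin n → ℕ) := by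
  intro x y h
  exact Finset.card_le_card (Finset.monotone_filter_right I fun i _ hi => lt_of_lt_of_le hi h)

theorem notMem_of_blockIndex_eq {I : Finset ℕ} {x y : Fin n} (h : blockIndex I x = blockIndex I y)
    {i : ℕ} (hx : (x : ℕ) ≤ i) (hy : i < y) : i ∉ I := by
  intro hi
  have hsub : I.filter (· < (x : ℕ)) ⊆ I.filter (· < (y : ℕ)) :=
    Finset.monotone_filter_right I fun j _ hj => lt_trans (lt_of_lt_of_le hj hx) hy
  have hmem : i ∈ I.filter (· < (y : ℕ)) := Finset.mem_filter.2 ⟨hi, hy⟩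
  rw [← Finset.eq_of_subset_of_card_le hsub h.ge] at hmem
  exact absurd (Finset.mem_filter.1 hmem).2 hx.not_gt

theorem mem_descSeq {f : Fin n → ℕ} {i : ℕ} : i ∈ descSeq f ↔
    ∃ h : i + 1 < n, f ⟨i + 1, h⟩ < f ⟨i, Nat.lt_of_succ_lt h⟩ := by
  simp only [descSeq, Finset.mem_filter, Finset.mem_range, and_iff_right_iff_imp]
  rintro ⟨h, -⟩
  omega

theorem descSeq_subset_iff {f : Fin n → ℕ} (hf : Function.Injective f) (I : Finset ℕ) :
    descSeq f ⊆ I ↔ StrictMonoOnFibers (blockIndex I) f := by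
  constructor
  · intro hI x y hxy hb
    have step : ∀ i (h : i + 1 < n), (x : ℕ) ≤ i → i < y →
        f ⟨i, Nat.lt_of_succ_lt h⟩ < f ⟨i + 1, h⟩ := by
      intro i h hx hy
      refine lt_of_le_of_ne (not_lt.1 fun hlt => ?_) (hf.ne (by simp))
      exact notMem_of_blockIndex_eq hb hx hy (hI (mem_descSeq.2 ⟨h, hlt⟩))
    have main : ∀ j, (x : ℕ) + 1 ≤ j → ∀ h : j < n, j ≤ y → f x < f ⟨j, h⟩ := by
      intro j hj
      induction j, hj using Nat.le_induction with
      | base => exact fun h hy => step x h le_rfl hy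
      | succ j hj ih =>
        intro h hy
        exact (ih (by omega) (by omega)).trans (step j h (by omega) (by omega))
    exact main y hxy y.2 le_rfl
  · intro h i hi
    obtain ⟨hn, hlt⟩ := mem_descSeq.1 hi
    by_contra hiI
    refine hlt.not_gt (h (Fin.lt_def.2 (Nat.lt_succ_self i)) ?_)
    refine congrArg Finset.card (Finset.filter_congr fun j hj => ?_)
    have : j ≠ i := fun e => hiI (e ▸ hj)
    simp only
    omega

end Descents

theorem card_eq_of_card_subset_eq {α : Type*} [Fintype α] {F G : α → Finset ℕ}
    {P Q : α → Prop} [DecidablePred P] [DecidablePred Q]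
    (h : ∀ I, (Finset.univ.filter fun a => P a ∧ F a ⊆ I).card =
      (Finset.univ.filter fun a => Q a ∧ G a ⊆ I).card) (I : Finset ℕ) :
    (Finset.univ.filter fun a => P a ∧ F a = I).card =
      (Finset.univ.filter fun a => Q a ∧ G a = I).card := by
  have expand : ∀ (F : α → Finset ℕ) (P : α → Prop) [DecidablePred P] (I : Finset ℕ),
      (Finset.univ.filter fun a => P a ∧ F a ⊆ I).card =
        ∑ J ∈ I.powerset, (Finset.univ.filter fun a => P a ∧ F a = J).card := by
    intro F P _ I
    rw [Finset.card_eq_sum_card_fiberwise (f := F) (t := I.powerset)]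
    · refine Finset.sum_congr rfl fun J hJ => ?_
      rw [Finset.filter_filter]
      congr 1
      refine Finset.filter_congr fun a _ => ?_
      have := Finset.mem_powerset.1 hJ
      constructor
      · rintro ⟨⟨h1, -⟩, h2⟩
        exact ⟨h1, h2⟩
      · rintro ⟨h1, h2⟩
        exact ⟨⟨h1, h2 ▸ this⟩, h2⟩
    · intro a ha
      simpa using (Finset.mem_filter.1 ha).2.2
  induction I using Finset.strongInduction with
  | H I ih =>
    have hI := h I
    rw [expand F P, expand G Q, ← Finset.add_sum_erase _ _ (Finset.mem_powerset_self I),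
      ← Finset.add_sum_erase _ _ (Finset.mem_powerset_self I),
      show I.powerset.erase I = I.ssubsets from rfl,
      Finset.sum_congr rfl fun J hJ => ih J (Finset.mem_ssubsets.1 hJ)] at hI
    exact Nat.add_right_cancel hI

theorem card_descSeq_subset (m : ℕ) (k : Fin (m + 1)) (I : Finset ℕ) :
    (Finset.univ.filter fun t : Equiv.Perm (Fin (m + 1)) =>
      t (Fin.last m) = k ∧ descSeq (successorSeq t) ⊆ I).card =
    (Finset.univ.filter fun s : Equiv.Perm (Fin (m + 1)) =>
      s (Fin.last m) = k ∧ descSet s.symm ⊆ I).card := by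
  have hβ : Monotone (blockIndex I : Fin (m + 1) → ℕ) := blockIndex_monotone I
  have hF : ∀ t : Equiv.Perm (Fin (m + 1)), descSeq (successorSeq t) ⊆ I ↔
      StrictMonoOnFibers (blockIndex I) (successorSeq t) := fun t =>
    descSeq_subset_iff (successorSeq_injective t) I
  have hG : ∀ s : Equiv.Perm (Fin (m + 1)), descSet s.symm ⊆ I ↔
      StrictMonoOnFibers (blockIndex I) s.symm := fun s =>
    descSeq_subset_iff (Fin.val_injective.comp s.symm.injective) I
  choose g hg1 hg2 using fun t => exists_symm_of_word hβ t
  refine Finset.card_bij (fun t _ => g t) ?_ ?_ ?_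
  · intro t ht
    simp only [Finset.mem_filter, Finset.mem_univ, true_and, hF, hG] at ht ⊢
    exact ⟨(apply_last_eq (hg1 t).symm ht.2 (hg2 t)).symm.trans ht.1, hg2 t⟩
  · intro t ht t' ht' h
    simp only [Finset.mem_filter, Finset.mem_univ, true_and, hF] at ht ht'
    exact eq_of_comp_eq_of_successorSeq hβ ht.2 ht'.2 (by rw [← hg1 t, ← hg1 t', h])
  · intro s hs
    simp only [Finset.mem_filter, Finset.mem_univ, true_and, hG] at hs
    obtain ⟨t, ht1, ht2⟩ := exists_successorSeq_of_word hβ s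
    refine ⟨t, ?_, eq_of_comp_eq_of_symm hβ (hg2 t) hs.2 ((hg1 t).trans ht1)⟩
    simp only [Finset.mem_filter, Finset.mem_univ, true_and, hF]
    exact ⟨(apply_last_eq ht1 ht2 hs.2).trans hs.1, ht2⟩

theorem exists_equiv_descSeq (m : ℕ) :
    ∃ e : Equiv.Perm (Fin (m + 1)) ≃ Equiv.Perm (Fin (m + 1)), ∀ t,
      (e t) (Fin.last m) = t (Fin.last m) ∧ descSet (e t).symm = descSeq (successorSeq t) := by
  have hcard : ∀ c : Fin (m + 1) × Finset ℕ,
      Nonempty ({t : Equiv.Perm (Fin (m + 1)) //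
          (t (Fin.last m), descSeq (successorSeq t)) = c} ≃
        {s : Equiv.Perm (Fin (m + 1)) // (s (Fin.last m), descSet s.symm) = c}) := by
    rintro ⟨k, I⟩
    refine ⟨Fintype.equivOfCardEq ?_⟩
    rw [Fintype.card_subtype, Fintype.card_subtype]
    simpa only [Prod.mk.injEq] using card_eq_of_card_subset_eq (card_descSeq_subset m k) I
  refine ⟨Equiv.ofFiberEquiv fun c => (hcard c).some, fun t => ?_⟩
  have h := Equiv.ofFiberEquiv_map (fun c => (hcard c).some) t
  exact Prod.ext_iff.1 h

section Cycles

variable {m : ℕ}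

theorem successorSeq_apply (t : Equiv.Perm (Fin (m + 1))) (i : ℕ) (h : i + 1 < m + 1) :
    successorSeq t (t ⟨i, Nat.lt_of_succ_lt h⟩) = t ⟨i + 1, h⟩ + 1 := by
  simp only [successorSeq, Equiv.symm_apply_apply]
  exact valueOrTop_of_lt t h

theorem inU_successorSeq (t : Equiv.Perm (Fin (m + 1))) : InU (m + 1) (successorSeq t) := by
  have hpow : ∀ (k : ℕ) (x : Fin (m + 1)),
      ((t * Equiv.addRight 1 * t⁻¹ : Equiv.Perm (Fin (m + 1))) ^ k) x =
        t (t⁻¹ x + Fin.ofNat (m + 1) k) := by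
    intro k x
    induction k with
    | zero => simp
    | succ k ih =>
      rw [pow_succ', Equiv.Perm.mul_apply, ih]
      have hk : Fin.ofNat (m + 1) (k + 1) = Fin.ofNat (m + 1) k + 1 :=
        Fin.ext (by simp [Fin.val_add])
      rw [hk]
      simp [add_assoc]
  refine ⟨t * Equiv.addRight 1 * t⁻¹, t (Fin.last m), fun x y => ?_, ?_⟩
  · refine ⟨(t⁻¹ y - t⁻¹ x : Fin (m + 1)), ?_⟩
    rw [hpow, Fin.ofNat_val_eq_self]
    simp
  · funext x
    obtain ⟨i, rfl⟩ := t.surjective x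
    rcases eq_or_ne i (Fin.last m) with rfl | hi
    · rw [successorSeq_last, Function.update_self]
    · rw [Function.update_of_ne (t.injective.ne hi)]
      have hlt : (i : ℕ) + 1 < m + 1 := by
        have := Fin.val_lt_last hi
        omega
      have hsucc : i + 1 = ⟨(i : ℕ) + 1, hlt⟩ :=
        Fin.ext (Fin.val_add_one_of_lt (Fin.lt_last_iff_ne_last.2 hi))
      rw [show i = ⟨(i : ℕ), Nat.lt_of_succ_lt hlt⟩ from rfl, successorSeq_apply t i hlt]
      simp [hsucc]

theorem successorSeq_inj {s t : Equiv.Perm (Fin (m + 1))}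
    (h : successorSeq s = successorSeq t) : s = t := by
  have main : ∀ i, i ≤ m → ∀ hi : i < m + 1, s ⟨i, hi⟩ = t ⟨i, hi⟩ := by
    intro i hi
    induction hi using Nat.decreasingInduction with
    | self =>
      intro _
      exact ((successorSeq_eq_iff s _).1 (by rw [h]; exact successorSeq_last t))
    | of_succ i hi ih =>
      intro _
      apply successorSeq_injective t
      rw [successorSeq_apply t i (by omega), ← h, successorSeq_apply s i (by omega),
        ih (by omega)]
  exact Equiv.ext fun i => main i (by omega) i.2

theorem exists_successorSeq_eq {τ : Fin (m + 1) → ℕ} (h : InU (m + 1) τ) :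
    ∃ t, successorSeq t = τ := by
  obtain ⟨π, k, hπ, rfl⟩ := h
  have hinj : Function.Injective fun i : Fin (m + 1) => (π ^ ((i : ℕ) + 1)) k := by
    refine Finite.injective_iff_surjective.2 fun y => ?_
    have hord : ∃ d, 0 < d ∧ d ≤ m + 1 ∧ (π ^ d) k = k := by
      obtain ⟨i, j, hne, hij⟩ := Fintype.exists_ne_map_eq_of_card_lt
        (fun i : Fin (m + 2) => (π ^ (i : ℕ)) k) (by simp)
      wlog hlt : i < j generalizing i j
      · exact this j i hne.symm hij.symm (lt_of_le_of_ne (not_lt.1 hlt) hne.symm)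
      have hlt' : (i : ℕ) < j := hlt
      refine ⟨j - i, by omega, by omega, ?_⟩
      apply (π ^ (i : ℕ)).injective
      rw [← Equiv.Perm.mul_apply, ← pow_add, Nat.add_sub_cancel' hlt'.le]
      exact hij.symm
    obtain ⟨d, hd0, hdm, hd⟩ := hord
    obtain ⟨r, hr⟩ := hπ (π k) y
    have hmod : (π ^ (r % d)) (π k) = y := by
      have hfix : ((π ^ d) ^ (r / d)) (π k) = π k := by
        rw [Equiv.Perm.pow_apply_eq_self_of_apply_eq_self]
        rw [← Equiv.Perm.mul_apply, ← pow_succ, pow_succ', Equiv.Perm.mul_apply, hd]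
      rw [← hr]
      conv_rhs => rw [← Nat.mod_add_div r d, pow_add, pow_mul, Equiv.Perm.mul_apply, hfix]
    have hlt := Nat.mod_lt r hd0
    refine ⟨⟨r % d, by omega⟩, ?_⟩
    simp only [pow_succ, Equiv.Perm.mul_apply]
    exact hmod
  let t : Equiv.Perm (Fin (m + 1)) :=
    Equiv.ofBijective _ (Finite.injective_iff_bijective.1 hinj)
  have ht : ∀ i (hi : i < m + 1), t ⟨i, hi⟩ = (π ^ (i + 1)) k := fun i hi => rfl
  have hk : t (Fin.last m) = k := by
    obtain ⟨⟨i, hi⟩, hik⟩ := t.surjective k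
    rcases Nat.lt_or_ge i m with him | him
    · have h1 : t ⟨i + 1, by omega⟩ = t ⟨0, by omega⟩ := by
        rw [ht, ht, pow_succ', Equiv.Perm.mul_apply, ← ht i hi, hik]
        simp
      have := t.injective h1
      simp at this
    · have : (⟨i, hi⟩ : Fin (m + 1)) = Fin.last m := Fin.ext (by simp; omega)
      rwa [← this]
  refine ⟨t, funext fun x => ?_⟩
  obtain ⟨⟨i, hi⟩, rfl⟩ := t.surjective x
  rcases Nat.lt_or_ge i m with him | him
  · rw [successorSeq_apply t i (by omega), Function.update_of_ne, ht, ht, pow_succ',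
      Equiv.Perm.mul_apply]
    rw [← hk]
    exact t.injective.ne (Fin.ne_of_val_ne (by simp; omega))
  · have : (⟨i, hi⟩ : Fin (m + 1)) = Fin.last m := Fin.ext (by simp; omega)
    rw [this, successorSeq_last, hk, Function.update_self]

end Cycles

theorem stmt7 (n : ℕ) (hn : 1 ≤ n) :
    ∃ ψ : {τ : Fin n → ℕ // InU n τ} ≃ Equiv.Perm (Fin n),
      ∀ τ : {τ : Fin n → ℕ // InU n τ},
        descSeq τ.1 = descSet (ψ τ) ∧
        ∀ k : Fin n, τ.1 k = n + 1 → ((ψ τ) k : ℕ) + 1 = n := by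
  obtain ⟨m, rfl⟩ : ∃ m, n = m + 1 := ⟨n - 1, by omega⟩
  let u : Equiv.Perm (Fin (m + 1)) ≃ {τ : Fin (m + 1) → ℕ // InU (m + 1) τ} :=
    Equiv.ofBijective (fun t => ⟨successorSeq t, inU_successorSeq t⟩)
      ⟨fun s t h => successorSeq_inj (congrArg Subtype.val h), fun τ => by
        obtain ⟨t, ht⟩ := exists_successorSeq_eq τ.2
        exact ⟨t, Subtype.ext ht⟩⟩
  obtain ⟨e, he⟩ := exists_equiv_descSeq m
  refine ⟨(u.symm.trans e).trans (Equiv.inv _), fun τ => ?_⟩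
  obtain ⟨t, rfl⟩ := u.surjective τ
  have hψ : ((u.symm.trans e).trans (Equiv.inv _)) (u t) = (e t).symm := by
    simp only [Equiv.trans_apply, Equiv.symm_apply_apply]
    rfl
  rw [hψ]
  refine ⟨(he t).2.symm, fun k hk => ?_⟩
  have hk' : t (Fin.last m) = k := (successorSeq_eq_iff t k).1 hk
  rw [← hk', ← (he t).1, Equiv.symm_apply_apply, Fin.val_last]
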